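/- Under the standing assumptions, for each K > 0 there exists L_0 = L_0(K) such that for each natural number L ≥ L_0 and each M > 0 there exists R_0 = R_0(L,M) > 0 satisfying the following. Let P_1 and P_2 be d_S-paths, with P_l connecting a_l ∈ G to b_l ∈ G (l = 1,2). Let g_1, …, g_m ∈ G be such that for each i = 1, 2 the sequence (a_i x_0, g_1Υ_L, …, g_mΥ_L, b_i x_0) is K-aligned, and let k ≤ m. Then one of the following holds: (1) for every subset I ⊆ {1,…,m} of cardinality k there exists i ∈ I such that d_S(P_l, g_i) < R_0 for both l = 1 and l = 2; or (2) Len(P_1) + Len(P_2) ≥ M·k. -/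

import Mathlib

namespace AcylCount

/-! ### Geodesic segments and Gromov hyperbolicity -/

/-- A finite geodesic segment in a metric space, parametrized by arclength on `[0, len]`,
oriented from `initial := toFun 0` to `terminal := toFun len`. -/
structure GeodesicSegment (X : Type*) [MetricSpace X] where
  len : ℝ
  len_nonneg : 0 ≤ len
  toFun : ℝ → X
  isom : ∀ s ∈ Set.Icc (0:ℝ) len, ∀ t ∈ Set.Icc (0:ℝ) len,
    dist (toFun s) (toFun t) = |s - t|

namespace GeodesicSegment

variable {X : Type*} [MetricSpace X]

/-- The initial point of a geodesic segment. -/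
def initial (γ : GeodesicSegment X) : X := γ.toFun 0

/-- The terminal point of a geodesic segment. -/
def terminal (γ : GeodesicSegment X) : X := γ.toFun γ.len

/-- The image (underlying set) of a geodesic segment. -/
def seg (γ : GeodesicSegment X) : Set X := γ.toFun '' Set.Icc 0 γ.len

/-- The translate of a geodesic segment by an isometry. -/
def translate (γ : GeodesicSegment X) (f : X → X) (hf : Isometry f) :
    GeodesicSegment X where
  len := γ.len
  len_nonneg := γ.len_nonneg
  toFun := f ∘ γ.toFun
  isom := fun s hs t ht => by
    simp only [Function.comp_apply, hf.dist_eq]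
    exact γ.isom s hs t ht

/-- The degenerate geodesic segment consisting of a single point. -/
def point (p : X) : GeodesicSegment X where
  len := 0
  len_nonneg := le_refl 0
  toFun := fun _ => p
  isom := fun s hs t ht => by
    have hs0 : s = 0 := le_antisymm hs.2 hs.1
    have ht0 : t = 0 := le_antisymm ht.2 ht.1
    simp [hs0, ht0]

/-- `η` is a subsegment of `γ`. -/
def IsSubsegment (η γ : GeodesicSegment X) : Prop :=
  ∃ a b : ℝ, 0 ≤ a ∧ a ≤ b ∧ b ≤ γ.len ∧ η.len = b - a ∧
    ∀ t ∈ Set.Icc (0:ℝ) η.len, η.toFun t = γ.toFun (a + t)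

/-- `p` occurs (weakly) before `q` along the oriented geodesic segment `γ`. -/
def Before (γ : GeodesicSegment X) (p q : X) : Prop :=
  ∃ s t : ℝ, s ∈ Set.Icc (0:ℝ) γ.len ∧ t ∈ Set.Icc (0:ℝ) γ.len ∧ s ≤ t ∧
    γ.toFun s = p ∧ γ.toFun t = q

end GeodesicSegment

/-- A geodesic metric space: every two points are joined by a geodesic segment. -/
def IsGeodesicSpace (X : Type*) [MetricSpace X] : Prop :=
  ∀ x y : X, ∃ γ : GeodesicSegment X, γ.initial = x ∧ γ.terminal = y

/-- δ-hyperbolicity via slim triangles: each side of a geodesic triangle lies in the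
closed δ-neighborhood of the union of the other two sides. -/
def IsDeltaHyperbolic (X : Type*) [MetricSpace X] (δ : ℝ) : Prop :=
  ∀ γ₁ γ₂ γ₃ : GeodesicSegment X,
    γ₁.initial = γ₃.initial → γ₁.terminal = γ₂.initial → γ₂.terminal = γ₃.terminal →
    γ₃.seg ⊆ Metric.cthickening δ (γ₁.seg ∪ γ₂.seg)

variable {X : Type*} [MetricSpace X]

/-- The closest point projection of `x` to (the image of) the geodesic `γ`. -/
def proj (γ : GeodesicSegment X) (x : X) : Set X :=
  {p | p ∈ γ.seg ∧ dist x p = Metric.infDist x γ.seg}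

/-- The closest point projection of a set `A` to the geodesic `γ`. -/
def projSet (γ : GeodesicSegment X) (A : Set X) : Set X :=
  ⋃ a ∈ A, proj γ a

/-- The ordered pair of oriented geodesic segments `(γ, η)` is `K`-aligned. -/
def AlignedPair (K : ℝ) (γ η : GeodesicSegment X) : Prop :=
  Metric.diam (projSet γ η.seg ∪ {γ.terminal}) < K ∧
  Metric.diam (projSet η γ.seg ∪ {η.initial}) < K

/-- A sequence of oriented geodesic segments is `K`-aligned if each consecutive
pair is `K`-aligned. -/
def AlignedSeq (K : ℝ) (l : List (GeodesicSegment X)) : Prop :=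
  l.Chain' (AlignedPair K)

/-- The Gromov product `(y, z)_x`. -/
noncomputable def gromovProd (x y z : X) : ℝ := (dist y x + dist x z - dist y z) / 2

/-! ### Word metric -/

variable {G : Type*} [Group G]

/-- The word length of `g` with respect to the (symmetrized) generating set `S`. -/
noncomputable def wordLength (S : Finset G) (g : G) : ℕ :=
  sInf {n | ∃ l : List G, l.length = n ∧ (∀ x ∈ l, x ∈ S ∨ x⁻¹ ∈ S) ∧ l.prod = g}

/-- The word metric on `G` with respect to `S`. -/
noncomputable def wordDist (S : Finset G) (g h : G) : ℕ := wordLength S (g⁻¹ * h)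

/-- The ball of radius `r` in the word metric, centered at the identity. -/
def ball (S : Finset G) (r : ℝ) : Set G := {g | (wordLength S g : ℝ) ≤ r}

/-- `G` has no cyclic subgroup of finite index. -/
def NonVirtuallyCyclic (G : Type*) [Group G] : Prop :=
  ¬ ∃ H : Subgroup G, H.FiniteIndex ∧ IsCyclic H

/-! ### Isometric actions, loxodromics, WPD -/

/-- `g` is a loxodromic isometry for the action `ρ` with basepoint `x0`: the asymptotic
translation length `τ_X(g) = lim dist x0 (g^n x0) / n` exists and is positive. -/
def IsLoxodromic (ρ : G → X → X) (x0 : X) (g : G) : Prop :=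
  ∃ τ : ℝ, 0 < τ ∧
    Filter.Tendsto (fun n : ℕ => dist x0 (ρ (g ^ n) x0) / n) Filter.atTop (nhds τ)

/-- The WPD (weak proper discontinuity) property of `g` for the action `ρ` with
basepoint `x0`. -/
def HasWPD (ρ : G → X → X) (x0 : X) (g : G) : Prop :=
  ∀ K : ℝ, 0 < K → ∃ N M : ℕ,
    {h : G | dist x0 (ρ h x0) < K ∧ dist (ρ (g ^ N) x0) (ρ h (ρ (g ^ N) x0)) < K}.Finite ∧
    {h : G | dist x0 (ρ h x0) < K ∧ dist (ρ (g ^ N) x0) (ρ h (ρ (g ^ N) x0)) < K}.ncard < M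

/-- The list of translated geodesics `h 1 • Υ, …, h m • Υ`. -/
def transList (ρ : G → X → X) (hisom : ∀ g : G, Isometry (ρ g))
    (Υ : GeodesicSegment X) (h : ℕ → G) (m : ℕ) : List (GeodesicSegment X) :=
  (List.range m).map fun i => Υ.translate (ρ (h (i + 1))) (hisom _)

/-- The specification of the constant `E₀` from Fact 2.7 (Bestvina–Fujiwara):
(i) Gromov product bounds, (ii) the WPD-type conclusion for large projections. -/
def E0Spec (S : Finset G) (ρ : G → X → X) (x0 : X) (φ : G) (E0 : ℝ) : Prop :=
  0 < E0 ∧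
  (∀ g : G, ∃ s t : G, (s ∈ S ∨ s = 1) ∧ (t ∈ S ∨ t = 1) ∧
    (∀ i : ℤ, 0 < i → gromovProd x0 (ρ (φ ^ i) x0) (ρ (s * g) x0) ≤ E0) ∧
    (∀ j : ℤ, j < 0 → gromovProd x0 (ρ (φ ^ j) x0) (ρ (t * g) x0) ≤ E0)) ∧
  (∀ n : ℕ, 0 < n → ∀ g : G, ∀ γ : GeodesicSegment X,
    γ.initial = x0 → γ.terminal = ρ (φ ^ n) x0 →
    ∀ p ∈ proj γ (ρ g x0), ∀ q ∈ proj γ (ρ (g * φ ^ n) x0),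
      γ.Before p q → E0 < dist p q →
      ∃ i j : ℕ, i ≤ n ∧ j ≤ n ∧ (wordDist S (φ ^ i) (g * φ ^ j) : ℝ) < E0)

/-- The set `V_{L,ε}(n)`. Here `Υ` is the chosen geodesic `Υ_L = [x₀, φ^L x₀]`. -/
def Vset (S : Finset G) (ρ : G → X → X) (hisom : ∀ g : G, Isometry (ρ g)) (x0 : X)
    (δ E0 : ℝ) (Υ : GeodesicSegment X) (ε : ℝ) (n : ℕ) : Set G :=
  {g | g ∈ ball S (n:ℝ) ∧ ∃ h : ℕ → G,
    AlignedSeq (6 * E0 + 300 * δ)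
      ([GeodesicSegment.point x0] ++ transList ρ hisom Υ h ⌈ε * (n:ℝ)⌉₊ ++
        [GeodesicSegment.point (ρ g x0)])}

/-- The set `W_{L,ε}(n)`. Here `Υ` is the chosen geodesic `Υ_L = [x₀, φ^L x₀]`. -/
def Wset (S : Finset G) (ρ : G → X → X) (hisom : ∀ g : G, Isometry (ρ g)) (x0 : X)
    (δ E0 : ℝ) (Υ : GeodesicSegment X) (ε : ℝ) (n : ℕ) : Set G :=
  {g | g ∈ ball S (n:ℝ) ∧ ∃ h : ℕ → G,
    AlignedSeq (6 * E0 + 360 * δ)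
      ([GeodesicSegment.point x0] ++ transList ρ hisom Υ h ⌈ε * (n:ℝ)⌉₊ ++
        [GeodesicSegment.point (ρ g x0)]) ∧
    AlignedPair (6 * E0 + 360 * δ) (GeodesicSegment.point (ρ g⁻¹ x0))
      (Υ.translate (ρ (h 1)) (hisom _)) ∧
    AlignedPair (6 * E0 + 360 * δ) (Υ.translate (ρ (h ⌈ε * (n:ℝ)⌉₊)) (hisom _))
      (GeodesicSegment.point (ρ (g ^ 2) x0))}

/-- The set `BAD_{L,ε}(n)`. -/
def BADset (S : Finset G) (ρ : G → X → X) (hisom : ∀ g : G, Isometry (ρ g)) (x0 : X)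
    (δ E0 : ℝ) (Υ : GeodesicSegment X) (ε : ℝ) (n : ℕ) : Set G :=
  ball S (n:ℝ) \ (ball S ((⌊(0.9:ℝ) * (n:ℝ)⌋₊ : ℕ) : ℝ) ∪ Vset S ρ hisom x0 δ E0 Υ ε n)

/-! ### Paths in the word metric -/

/-- `P` is a `d_S`-path connecting `a` to `b`. -/
noncomputable def IsPathFrom (S : Finset G) (P : List G) (a b : G) : Prop :=
  P ≠ [] ∧ P.Chain' (fun u v => wordDist S u v = 1) ∧ P.head? = some a ∧ P.getLast? = some b

/-- The distance `d_S(P, g)` from a path `P` to a group element `g`. -/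
noncomputable def pathDist (S : Finset G) (P : List G) (g : G) : ℕ :=
  sInf {d | ∃ v ∈ P, d = wordDist S v g}


/-! ### Elementary properties of geodesic segments -/

namespace GeodesicSegment

variable (γ : GeodesicSegment X)

lemma continuousOn_toFun : ContinuousOn γ.toFun (Set.Icc 0 γ.len) := by
  refine (LipschitzOnWith.of_dist_le_mul (K := 1) fun s hs t ht => ?_).continuousOn
  rw [γ.isom s hs t ht, Real.dist_eq]
  simp

lemma isCompact_seg : IsCompact γ.seg :=
  isCompact_Icc.image_of_continuousOn γ.continuousOn_toFun

lemma isPreconnected_seg : IsPreconnected γ.seg :=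
  isPreconnected_Icc.image _ γ.continuousOn_toFun

lemma initial_mem : γ.initial ∈ γ.seg :=
  ⟨0, ⟨le_rfl, γ.len_nonneg⟩, rfl⟩

lemma terminal_mem : γ.terminal ∈ γ.seg :=
  ⟨γ.len, ⟨γ.len_nonneg, le_rfl⟩, rfl⟩

lemma exists_dist_initial_terminal {t : ℝ} (ht : t ∈ Set.Icc 0 γ.len) :
    γ.toFun t ∈ γ.seg ∧ dist γ.initial (γ.toFun t) = t ∧
      dist (γ.toFun t) γ.terminal = γ.len - t := by
  refine ⟨⟨t, ht, rfl⟩, ?_, ?_⟩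
  · rw [initial, γ.isom 0 ⟨le_rfl, γ.len_nonneg⟩ t ht, zero_sub, abs_neg, abs_of_nonneg ht.1]
  · rw [terminal, γ.isom t ht _ ⟨γ.len_nonneg, le_rfl⟩, abs_sub_comm,
      abs_of_nonneg (sub_nonneg.2 ht.2)]

lemma dist_initial_terminal : dist γ.initial γ.terminal = γ.len :=
  (γ.exists_dist_initial_terminal ⟨γ.len_nonneg, le_rfl⟩).2.1

lemma dist_add_dist {c : X} (hc : c ∈ γ.seg) :
    dist γ.initial c + dist c γ.terminal = dist γ.initial γ.terminal := by
  obtain ⟨t, ht, rfl⟩ := hc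
  obtain ⟨-, h1, h2⟩ := γ.exists_dist_initial_terminal ht
  rw [h1, h2, γ.dist_initial_terminal]
  ring

end GeodesicSegment

/-! ### The four-point condition -/

/-- The four-point form of Gromov hyperbolicity, with additive error `κ`. -/
def FourPoint (X : Type*) [MetricSpace X] (κ : ℝ) : Prop :=
  ∀ x y z w : X,
    dist x y + dist z w ≤ max (dist x z + dist y w) (dist x w + dist y z) + κ

section Hyperbolic

lemma IsDeltaHyperbolic.seg_subset_thickening {δ : ℝ} (hδ : 0 < δ)
    (hhyp : IsDeltaHyperbolic X δ) {γ₁ γ₂ γ₃ : GeodesicSegment X}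
    (h₁ : γ₁.initial = γ₃.initial) (h₂ : γ₁.terminal = γ₂.initial)
    (h₃ : γ₂.terminal = γ₃.terminal) :
    γ₃.seg ⊆ Metric.thickening (2 * δ) γ₁.seg ∪ Metric.thickening (2 * δ) γ₂.seg := by
  rw [← Metric.thickening_union]
  exact (hhyp γ₁ γ₂ γ₃ h₁ h₂ h₃).trans
    (Metric.cthickening_subset_thickening' (by linarith) (by linarith) _)

/-- A geodesic comes within the Gromov product (up to a constant) of any point. -/
lemma IsDeltaHyperbolic.exists_dist_le_gromovProd {δ : ℝ} (hδ : 0 < δ)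
    (hgeo : IsGeodesicSpace X) (hhyp : IsDeltaHyperbolic X δ) (x : X) (γ : GeodesicSegment X) :
    ∃ c ∈ γ.seg, dist x c ≤ gromovProd x γ.initial γ.terminal + 4 * δ := by
  obtain ⟨α, hα₁, hα₂⟩ := hgeo γ.initial x
  obtain ⟨β, hβ₁, hβ₂⟩ := hgeo x γ.terminal
  have hcov := hhyp.seg_subset_thickening hδ hα₁ (hα₂.trans hβ₁.symm) hβ₂
  have hself : ∀ s : Set X, s ⊆ Metric.thickening (2 * δ) s :=
    Metric.self_subset_thickening (by linarith)
  obtain ⟨c, hc, hcα, hcβ⟩ := γ.isPreconnected_seg _ _ Metric.isOpen_thickening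
    Metric.isOpen_thickening hcov
    ⟨γ.initial, γ.initial_mem, hself _ (hα₁ ▸ α.initial_mem)⟩
    ⟨γ.terminal, γ.terminal_mem, hself _ (hβ₂ ▸ β.terminal_mem)⟩
  refine ⟨c, hc, ?_⟩
  obtain ⟨c₁, hc₁, hd₁⟩ := Metric.mem_thickening_iff.1 hcα
  obtain ⟨c₂, hc₂, hd₂⟩ := Metric.mem_thickening_iff.1 hcβ
  have e₁ := α.dist_add_dist hc₁
  have e₂ := β.dist_add_dist hc₂
  have e₃ := γ.dist_add_dist hc
  rw [hα₁, hα₂] at e₁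
  rw [hβ₁, hβ₂] at e₂
  have t₁ := dist_triangle x c₁ c
  have t₂ := dist_triangle x c₂ c
  have t₃ := dist_triangle γ.initial c₁ c
  have t₄ := dist_triangle c c₂ γ.terminal
  rw [dist_comm c₁ c] at t₁ t₃
  rw [dist_comm c₂ c] at t₂
  rw [dist_comm c₁ x] at e₁
  rw [gromovProd, dist_comm γ.initial x]
  rw [dist_comm γ.initial x] at e₁
  linarith

lemma IsDeltaHyperbolic.fourPoint {δ : ℝ} (hδ : 0 < δ)
    (hgeo : IsGeodesicSpace X) (hhyp : IsDeltaHyperbolic X δ) : FourPoint X (12 * δ) := by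
  have key : ∀ (x : X) (γ : GeodesicSegment X), ∀ d ∈ Metric.thickening (2 * δ) γ.seg,
      gromovProd x γ.initial γ.terminal ≤ dist x d + 2 * δ := by
    intro x γ d hd
    obtain ⟨e, he, hde⟩ := Metric.mem_thickening_iff.1 hd
    have h := γ.dist_add_dist he
    have t₁ := dist_triangle γ.initial e x
    have t₂ := dist_triangle x e γ.terminal
    have t₃ := dist_triangle x d e
    rw [dist_comm e x] at t₁
    rw [gromovProd]
    linarith
  intro x y z w
  obtain ⟨γ, hγ₁, hγ₂⟩ := hgeo z w
  obtain ⟨α, hα₁, hα₂⟩ := hgeo z y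
  obtain ⟨β, hβ₁, hβ₂⟩ := hgeo y w
  obtain ⟨c, hc, hxc⟩ := hhyp.exists_dist_le_gromovProd hδ hgeo x γ
  have hcov := hhyp.seg_subset_thickening hδ (hα₁.trans hγ₁.symm) (hα₂.trans hβ₁.symm)
    (hβ₂.trans hγ₂.symm)
  rw [hγ₁, hγ₂, gromovProd] at hxc
  rw [← sub_le_iff_le_add, le_max_iff]
  rcases hcov hc with h | h
  · have := key x α c h
    rw [hα₁, hα₂, gromovProd] at this
    right
    rw [dist_comm z x, dist_comm z y] at this
    rw [dist_comm z x] at hxc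
    linarith
  · have := key x β c h
    rw [hβ₁, hβ₂, gromovProd] at this
    left
    rw [dist_comm y x] at this
    rw [dist_comm z x] at hxc
    linarith

lemma gromovProd_comm (x y z : X) : gromovProd x y z = gromovProd x z y := by
  rw [gromovProd, gromovProd, dist_comm y x, dist_comm z x, dist_comm z y]
  ring

lemma gromovProd_add (x u v : X) : gromovProd u x v + gromovProd v x u = dist u v := by
  rw [gromovProd, gromovProd, dist_comm v u]
  ring

lemma gromovProd_le_dist (u v x : X) : gromovProd u x v ≤ dist u v := by
  have := dist_triangle x v u
  rw [dist_comm v u] at this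
  rw [gromovProd]
  linarith

variable {κ : ℝ}

lemma FourPoint.gromovProd_le (hX : FourPoint X κ) (x y z w : X) :
    gromovProd x y z ≤ gromovProd x y w + κ / 2 ∨
      gromovProd x z w ≤ gromovProd x y w + κ / 2 := by
  have h := hX x z y w
  rw [← sub_le_iff_le_add, le_max_iff] at h
  simp only [gromovProd, dist_comm y x, dist_comm z x] at *
  rw [dist_comm z y] at h
  rcases h with h | h
  · right; linarith
  · left; linarith

/-- A closest point projection determines the Gromov products with the endpoints. -/
lemma FourPoint.gromovProd_le_of_mem_proj (hX : FourPoint X κ) (γ : GeodesicSegment X)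
    {x p : X} (hp : p ∈ proj γ x) :
    gromovProd γ.initial x γ.terminal ≤ dist p γ.initial + κ ∧
      gromovProd γ.terminal x γ.initial ≤ dist p γ.terminal + κ := by
  have h0 : 0 ≤ gromovProd γ.initial x γ.terminal := by
    rw [gromovProd]
    linarith [dist_triangle x γ.initial γ.terminal]
  have h1 : gromovProd γ.initial x γ.terminal ≤ γ.len :=
    γ.dist_initial_terminal ▸ gromovProd_le_dist _ _ _
  obtain ⟨hc, d₁, d₂⟩ := γ.exists_dist_initial_terminal ⟨h0, h1⟩
  set c := γ.toFun (gromovProd γ.initial x γ.terminal)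
  have hpc : dist x p ≤ dist x c := hp.2 ▸ Metric.infDist_le_dist_of_mem hc
  have h := hX x c γ.initial γ.terminal
  have e := γ.dist_initial_terminal
  rw [dist_comm c γ.initial, d₁, d₂] at h
  have t₁ := dist_triangle x p γ.initial
  have t₂ := dist_triangle x p γ.terminal
  have hm : max (dist x γ.initial + (γ.len - gromovProd γ.initial x γ.terminal))
      (dist x γ.terminal + gromovProd γ.initial x γ.terminal) ≤
      (dist x γ.initial + dist x γ.terminal + γ.len) / 2 := by
    simp only [gromovProd]
    rw [e]
    apply max_le <;> linarith
  simp only [gromovProd, dist_comm γ.terminal γ.initial] at *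
  constructor <;> linarith

lemma FourPoint.gromovProd_le_of_diam_lt (hX : FourPoint X κ) (γ : GeodesicSegment X)
    {x : X} {A : Set X} (hx : x ∈ A) {K : ℝ} :
    (Metric.diam (projSet γ A ∪ {γ.initial}) < K →
      gromovProd γ.initial x γ.terminal ≤ K + κ) ∧
    (Metric.diam (projSet γ A ∪ {γ.terminal}) < K →
      gromovProd γ.terminal x γ.initial ≤ K + κ) := by
  obtain ⟨p, hp, hpd⟩ := γ.isCompact_seg.exists_infDist_eq_dist ⟨_, γ.initial_mem⟩ x
  have hmem : p ∈ proj γ x := ⟨hp, hpd.symm⟩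
  have hpA : p ∈ projSet γ A := Set.mem_biUnion hx hmem
  have hsub : projSet γ A ⊆ γ.seg := Set.iUnion₂_subset fun _ _ _ h => h.1
  have hb : ∀ q ∈ γ.seg, dist p q ≤ Metric.diam (projSet γ A ∪ {q}) := fun q hq =>
    Metric.dist_le_diam_of_mem
      (γ.isCompact_seg.isBounded.subset (Set.union_subset hsub (Set.singleton_subset_iff.2 hq)))
      (Or.inl hpA) (Or.inr rfl)
  obtain ⟨h₁, h₂⟩ := hX.gromovProd_le_of_mem_proj γ hmem
  exact ⟨fun h => by linarith [hb _ γ.initial_mem], fun h => by linarith [hb _ γ.terminal_mem]⟩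

/-- A point cannot project both away from the end of a segment and away from the start of a
later segment aligned with it. -/
lemma FourPoint.gromovProd_le_or (hX : FourPoint X κ) (hκ : 0 < κ) {C : ℝ} (hC : 0 ≤ C)
    {u v u' v' : X} (h₁ : gromovProd v u' u ≤ C) (h₂ : gromovProd v v' u ≤ C)
    (h₃ : gromovProd u' v v' ≤ C) (p : X) :
    gromovProd v p u ≤ 3 * C + 3 * κ ∨ gromovProd u' p v' ≤ 3 * C + 3 * κ := by
  by_contra! h
  obtain ⟨ha, hb⟩ := h
  have e₁ : gromovProd u' p v ≤ C + κ / 2 := by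
    rcases hX.gromovProd_le u' v p v' with h | h
    · rw [gromovProd_comm]; linarith
    · linarith
  have e₂ : gromovProd v p u' ≤ C + κ / 2 := by
    rcases hX.gromovProd_le v u' p u with h | h
    · rw [gromovProd_comm]; linarith
    · linarith
  have e₃ := gromovProd_add p u' v
  have e₄ : gromovProd u' p v' ≤ gromovProd v p v' + dist u' v := by
    have t₁ := dist_triangle p v u'
    have t₂ := dist_triangle u' v v'
    rw [dist_comm v u'] at t₁
    simp only [gromovProd]
    linarith
  rcases hX.gromovProd_le v v' p u with h | h
  · rw [gromovProd_comm v v' p] at h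
    linarith
  · linarith

end Hyperbolic

/-! ### Growth of orbits of loxodromic isometries -/

/-- A sublinear sequence that roughly doubles at each record time is bounded. -/
lemma bddAbove_of_sublinear_of_doubling {b : ℕ → ℝ} (hb : ∀ n, 0 ≤ b n)
    (hlim : ∀ ε > 0, ∃ J : ℕ, ∀ j ≥ J, b j ≤ ε * j) {q : ℕ} {c : ℝ} (hc : 0 ≤ c)
    (hstep : ∀ n, q ≤ n → (∀ j ≤ n, b j ≤ b n) → 2 * b n - c ≤ b (2 * n - q)) :
    ∃ C, ∀ n, b n ≤ C := by
  by_contra! h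
  set s : ℝ := ∑ i ∈ Finset.range q, b i with hs
  have hs0 : 0 ≤ s := Finset.sum_nonneg fun i _ => hb i
  obtain ⟨n, hn⟩ := h (c + s)
  set β := b n - c with hβ
  have hβs : s < β := by linarith
  have grow : ∀ k : ℕ, ∃ j ≤ 2 ^ k * n, 2 ^ k * β + c ≤ b j := by
    intro k
    induction k with
    | zero => exact ⟨n, by simp, by simp [hβ]⟩
    | succ k ih =>
      obtain ⟨j, hj, hbj⟩ := ih
      obtain ⟨i, hi, himax⟩ := Finset.exists_max_image (Finset.range (j + 1)) b ⟨j, by simp⟩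
      have hij : i ≤ j := Nat.lt_succ_iff.1 (Finset.mem_range.1 hi)
      have hbi : b j ≤ b i := himax j (by simp)
      have h1 : (1 : ℝ) ≤ 2 ^ k := one_le_pow₀ (by norm_num)
      have hqi : q ≤ i := by
        by_contra! hlt
        have := Finset.single_le_sum (f := b) (fun i _ => hb i) (Finset.mem_range.2 hlt)
        nlinarith
      refine ⟨2 * i - q, ?_, ?_⟩
      · rw [pow_succ]
        have : i ≤ 2 ^ k * n := hij.trans hj
        have e : 2 ^ k * 2 * n = 2 * (2 ^ k * n) := by ring
        omega
      · have := hstep i hqi fun l hl => himax l (by simp; omega)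
        rw [pow_succ]
        linarith
  have hβ0 : 0 < β := by linarith
  obtain ⟨J, hJ⟩ := hlim (β / (2 * (n + 1))) (by positivity)
  obtain ⟨k, hk⟩ := pow_unbounded_of_one_lt (2 * (∑ i ∈ Finset.range J, b i) / β) one_lt_two
  rw [div_lt_iff₀ hβ0] at hk
  obtain ⟨j, hj, hbj⟩ := grow k
  have hsJ : 0 ≤ ∑ i ∈ Finset.range J, b i := Finset.sum_nonneg fun i _ => hb i
  have hk0 : (0 : ℝ) < 2 ^ k := by positivity
  rcases lt_or_ge j J with hjJ | hjJ
  · have := Finset.single_le_sum (f := b) (fun i _ => hb i) (Finset.mem_range.2 hjJ)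
    nlinarith
  · have h1 := hJ j hjJ
    have h2 : (j : ℝ) ≤ 2 ^ k * n := by exact_mod_cast hj
    have h3 : β / (2 * (n + 1)) * j ≤ 2 ^ k * β / 2 := by
      rw [div_mul_eq_mul_div, div_le_iff₀ (by positivity)]
      nlinarith [mul_le_mul_of_nonneg_left h2 hβ0.le, mul_pos hk0 hβ0]
    nlinarith [mul_pos hk0 hβ0]

/-- A subadditive sequence with the four-point property and positive linear growth rate `τ`
stays within bounded distance of `n * τ`. -/
lemma exists_le_mul_add_of_fourPoint {a : ℕ → ℝ} (ha : ∀ n, 0 ≤ a n)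
    (hsub : ∀ m n, a (m + n) ≤ a m + a n) {κ : ℝ} (hκ : 0 ≤ κ)
    (h4 : ∀ p q r, a (p + q) + a (q + r) ≤ max (a p + a r) (a (p + q + r) + a q) + κ)
    {τ : ℝ} (hτ : 0 < τ)
    (hlim : Filter.Tendsto (fun n : ℕ => a n / n) Filter.atTop (nhds τ)) :
    (∀ n : ℕ, n * τ ≤ a n) ∧ ∃ C, ∀ n : ℕ, a n ≤ n * τ + C := by
  have hlow : ∀ n : ℕ, n * τ ≤ a n := by
    intro n
    rcases Nat.eq_zero_or_pos n with rfl | hn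
    · simpa using ha 0
    have hmul : ∀ k : ℕ, a ((k + 1) * n) ≤ (k + 1) * a n := by
      intro k
      induction k with
      | zero => simp
      | succ k ih =>
        have := hsub ((k + 1) * n) n
        rw [show (k + 1 + 1) * n = (k + 1) * n + n by ring]
        push_cast
        linarith
    have hn' : (0 : ℝ) < n := by exact_mod_cast hn
    have ht : Filter.Tendsto (fun k : ℕ => (k + 1) * n) Filter.atTop Filter.atTop :=
      Filter.tendsto_atTop_mono (fun k => (Nat.le_succ k).trans (Nat.le_mul_of_pos_right _ hn)) Filter.tendsto_id
    have := le_of_tendsto (hlim.comp ht) (b := a n / n) (Filter.Eventually.of_forall fun k => by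
      simp only [Function.comp_apply]
      push_cast
      rw [div_le_div_iff₀ (by positivity) hn']
      nlinarith [hmul k])
    rw [le_div_iff₀ hn'] at this
    linarith
  refine ⟨hlow, ?_⟩
  obtain ⟨q, hq⟩ := exists_nat_gt (κ / τ)
  rw [div_lt_iff₀ hτ] at hq
  obtain ⟨C, hC⟩ := bddAbove_of_sublinear_of_doubling (b := fun n => a n - n * τ)
    (fun n => sub_nonneg.2 (hlow n)) (q := q) (c := a q - q * τ + κ)
    (fun ε hε => by
      obtain ⟨J, hJ⟩ := Filter.eventually_atTop.1
        (hlim.eventually_lt_const (show τ < τ + ε by linarith))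
      refine ⟨J + 1, fun j hj => ?_⟩
      have hj0 : (0 : ℝ) < j := by exact_mod_cast (by omega : 0 < j)
      have := hJ j (by omega)
      rw [div_lt_iff₀ hj0] at this
      linarith)
    (by linarith [hlow q])
    (fun n hqn hrec => by
      have h := h4 (n - q) q (n - q)
      have hr := hrec (n - q) (by omega)
      rw [Nat.sub_add_cancel hqn, Nat.add_sub_cancel' hqn,
        show n + (n - q) = 2 * n - q by omega] at h
      rw [← sub_le_iff_le_add, le_max_iff] at h
      rw [Nat.cast_sub hqn] at hr
      rw [Nat.cast_sub (by omega)]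
      push_cast
      rcases h with h | h
      · nlinarith
      · linarith)
  exact ⟨C, fun n => by linarith [hC n]⟩

section Action

variable {ρ : G → X → X} {κ : ℝ}

/-- A point almost on a geodesic is almost fixed by an isometry almost fixing the endpoints. -/
lemma FourPoint.dist_map_le (hX : FourPoint X κ) {f : X → X} (hf : Isometry f) (x y z : X)
    {A B : ℝ} (hx : dist x (f x) ≤ A) (hy : dist y (f y) ≤ A)
    (hz : dist x z + dist z y ≤ dist x y + B) : dist z (f z) ≤ A + B + κ := by
  have h := hX x y z (f z)
  have t₁ : dist x (f z) ≤ dist x z + A := by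
    linarith [dist_triangle x (f x) (f z), hf.dist_eq x z]
  have t₂ : dist y (f z) ≤ dist z y + A := by
    linarith [dist_triangle y (f y) (f z), hf.dist_eq y z, dist_comm z y]
  have hm : max (dist x z + dist y (f z)) (dist x (f z) + dist y z) ≤
      dist x z + dist z y + A := by
    rw [dist_comm y z]
    apply max_le <;> linarith
  linarith

/-- Orbits of loxodromic isometries: linear growth, and bounded deviation from additivity. -/
lemma FourPoint.orbit_growth (hX : FourPoint X κ) (hκ : 0 ≤ κ) (hisom : ∀ g : G, Isometry (ρ g))
    (hmul : ∀ g h : G, ∀ x : X, ρ (g * h) x = ρ g (ρ h x))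
    {x₀ : X} {φ : G} (hlox : IsLoxodromic ρ x₀ φ) :
    ∃ τ > 0, ∃ E ≥ 0, (∀ n : ℕ, n * τ ≤ dist x₀ (ρ (φ ^ n) x₀)) ∧
      ∀ N L : ℕ, N ≤ L → dist x₀ (ρ (φ ^ N) x₀) + dist (ρ (φ ^ N) x₀) (ρ (φ ^ L) x₀) ≤
        dist x₀ (ρ (φ ^ L) x₀) + E := by
  obtain ⟨τ, hτ, hlim⟩ := hlox
  have hd : ∀ m n : ℕ, dist (ρ (φ ^ m) x₀) (ρ (φ ^ (m + n)) x₀) = dist x₀ (ρ (φ ^ n) x₀) := by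
    intro m n
    rw [pow_add, hmul, (hisom _).dist_eq]
  obtain ⟨hlow, C, hC⟩ := exists_le_mul_add_of_fourPoint
    (a := fun n => dist x₀ (ρ (φ ^ n) x₀)) (fun n => dist_nonneg)
    (fun m n => hd m n ▸ dist_triangle _ _ _) hκ
    (fun p q r => by
      have h := hX x₀ (ρ (φ ^ (p + q)) x₀) (ρ (φ ^ p) x₀) (ρ (φ ^ (p + q + r)) x₀)
      rw [hd (p + q) r, add_assoc p q r, hd p (q + r), dist_comm (ρ (φ ^ (p + q)) x₀),
        hd p q] at h
      rwa [add_assoc p q r])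
    hτ hlim
  refine ⟨τ, hτ, 2 * |C|, by positivity, hlow, fun N L hNL => ?_⟩
  have h := hd N (L - N)
  rw [Nat.add_sub_cancel' hNL] at h
  rw [h]
  have h₁ := hC N
  have h₂ := hC (L - N)
  have h₃ := hlow L
  rw [Nat.cast_sub hNL] at h₂
  linarith [le_abs_self C]

/-- The WPD property for long segments: only finitely many elements almost fix both endpoints
of a sufficiently long orbit segment of `φ`. -/
lemma FourPoint.finite_setOf_dist_lt (hX : FourPoint X κ) (hκ : 0 ≤ κ)
    (hisom : ∀ g : G, Isometry (ρ g))
    (hmul : ∀ g h : G, ∀ x : X, ρ (g * h) x = ρ g (ρ h x))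
    {x₀ : X} {φ : G} (hlox : IsLoxodromic ρ x₀ φ) (hwpd : HasWPD ρ x₀ φ) {A : ℝ} (hA : 0 < A) :
    ∃ N : ℕ, ∀ L ≥ N, {h : G | dist x₀ (ρ h x₀) ≤ A ∧
      dist (ρ (φ ^ L) x₀) (ρ h (ρ (φ ^ L) x₀)) ≤ A}.Finite := by
  obtain ⟨τ, -, E, hE, -, hadd⟩ := hX.orbit_growth hκ hisom hmul hlox
  obtain ⟨N, -, hfin, -⟩ := hwpd (A + E + κ + 1) (by linarith)
  refine ⟨N, fun L hL => hfin.subset fun h ⟨h₁, h₂⟩ => ⟨by linarith, ?_⟩⟩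
  linarith [hX.dist_map_le (hisom h) _ _ _ h₁ h₂ (hadd N L hL)]

/-- If the segment from `x` to `y` starts near `u` and ends near `v`, with `u`, `v` far apart,
then it passes near `u`. -/
lemma FourPoint.gromovProd_le_of_crossing (hX : FourPoint X κ) (hκ : 0 ≤ κ) {C : ℝ} {u v x y : X}
    (hx : gromovProd u x v ≤ C) (hy : gromovProd v y u ≤ C)
    (huv : 2 * C + κ < dist u v) : gromovProd u x y ≤ C + κ / 2 := by
  have e := gromovProd_add y u v
  rcases hX.gromovProd_le u x y v with h | h
  · linarith
  · linarith

/-- Up to finitely many choices, a bounded word crosses a given long segment in only one way. -/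
lemma FourPoint.finite_crossings (hX : FourPoint X κ) (hκ : 0 < κ)
    (hisom : ∀ g : G, Isometry (ρ g))
    (hmul : ∀ g h : G, ∀ x : X, ρ (g * h) x = ρ g (ρ h x))
    {C : ℝ} {u v : X} (huv : 2 * C + κ < dist u v)
    (hfin : {h : G | dist u (ρ h u) ≤ 2 * C + 2 * κ + 1 ∧
      dist v (ρ h v) ≤ 2 * C + 2 * κ + 1}.Finite)
    (o : X) (w : G) :
    {p : G | gromovProd u (ρ p o) v ≤ C ∧ gromovProd v (ρ (p * w) o) u ≤ C}.Finite := by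
  set T := dist o (ρ w o)
  have hT : ∀ p : G, dist (ρ p o) (ρ (p * w) o) = T := fun p => by
    rw [hmul, (hisom p).dist_eq]
  set F : G → Fin 4 → ℤ := fun p => ![⌊dist u (ρ p o)⌋, ⌊dist u (ρ (p * w) o)⌋,
    ⌊dist v (ρ p o)⌋, ⌊dist v (ρ (p * w) o)⌋]
  have key : ∀ p : G, gromovProd u (ρ p o) v ≤ C → gromovProd v (ρ (p * w) o) u ≤ C →
      dist u (ρ p o) + dist u (ρ (p * w) o) ≤ T + 2 * C + κ ∧
      dist v (ρ p o) + dist v (ρ (p * w) o) ≤ T + 2 * C + κ := by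
    intro p h₁ h₂
    have a₁ := hX.gromovProd_le_of_crossing hκ.le h₁ h₂ huv
    have a₂ := hX.gromovProd_le_of_crossing hκ.le h₂ h₁ (by rwa [dist_comm])
    rw [gromovProd, hT, dist_comm (ρ p o)] at a₁
    rw [gromovProd, dist_comm (ρ (p * w) o) (ρ p o), hT, dist_comm (ρ (p * w) o)] at a₂
    constructor <;> linarith
  apply Set.Finite.of_finite_fibers F
  · apply (Set.Finite.pi' (t := fun _ : Fin 4 => Set.Icc 0 ⌊T + 2 * C + κ⌋)
      fun _ => Set.finite_Icc _ _).subset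
    rintro _ ⟨p, ⟨h₁, h₂⟩, rfl⟩ i
    obtain ⟨b₁, b₂⟩ := key p h₁ h₂
    have n₁ := dist_nonneg (x := u) (y := ρ p o)
    have n₂ := dist_nonneg (x := u) (y := ρ (p * w) o)
    have n₃ := dist_nonneg (x := v) (y := ρ p o)
    have n₄ := dist_nonneg (x := v) (y := ρ (p * w) o)
    fin_cases i
    · exact ⟨Int.floor_nonneg.2 n₁, Int.floor_le_floor (by linarith)⟩
    · exact ⟨Int.floor_nonneg.2 n₂, Int.floor_le_floor (by linarith)⟩
    · exact ⟨Int.floor_nonneg.2 n₃, Int.floor_le_floor (by linarith)⟩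
    · exact ⟨Int.floor_nonneg.2 n₄, Int.floor_le_floor (by linarith)⟩
  · rintro _ ⟨p, ⟨h₁, h₂⟩, rfl⟩
    apply (hfin.image (fun h => h * p)).subset
    rintro p' ⟨⟨h₁', h₂'⟩, hF⟩
    refine ⟨p' * p⁻¹, ?_, by group⟩
    have hFi : ∀ i, F p' i = F p i := fun i => congrFun hF i
    have f₁ := Int.abs_sub_lt_one_of_floor_eq_floor (hFi 0)
    have f₂ := Int.abs_sub_lt_one_of_floor_eq_floor (hFi 1)
    have f₃ := Int.abs_sub_lt_one_of_floor_eq_floor (hFi 2)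
    have f₄ := Int.abs_sub_lt_one_of_floor_eq_floor (hFi 3)
    rw [abs_lt] at f₁ f₂ f₃ f₄
    obtain ⟨b₁, b₂⟩ := key p h₁ h₂
    obtain ⟨b₁', b₂'⟩ := key p' h₁' h₂'
    have move : ∀ z q : _, dist (ρ (p' * p⁻¹) z) (ρ (p' * q) o) = dist z (ρ (p * q) o) := by
      intro z q
      rw [show p' * q = (p' * p⁻¹) * (p * q) by group, hmul (p' * p⁻¹), (hisom _).dist_eq]
    have main : ∀ z : X, |dist z (ρ p' o) - dist z (ρ p o)| ≤ 1 →
        |dist z (ρ (p' * w) o) - dist z (ρ (p * w) o)| ≤ 1 →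
        dist z (ρ p' o) + dist z (ρ (p' * w) o) ≤ T + 2 * C + κ →
        dist z (ρ (p' * p⁻¹) z) ≤ 2 * C + 2 * κ + 1 := by
      intro z g₁ g₂ g₃
      rw [abs_le] at g₁ g₂
      have m₁ := move z 1
      rw [mul_one, mul_one] at m₁
      have m₂ := move z w
      have h := hX (ρ p' o) (ρ (p' * w) o) z (ρ (p' * p⁻¹) z)
      rw [hT, dist_comm (ρ p' o) z, dist_comm (ρ (p' * w) o) z, dist_comm (ρ p' o),
        dist_comm (ρ (p' * w) o), m₁, m₂] at h
      rw [← sub_le_iff_le_add] at h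
      rcases le_max_iff.1 h with h | h <;> linarith
    exact ⟨main u (abs_le.2 ⟨f₁.1.le, f₁.2.le⟩) (abs_le.2 ⟨f₂.1.le, f₂.2.le⟩) b₁',
      main v (abs_le.2 ⟨f₃.1.le, f₃.2.le⟩) (abs_le.2 ⟨f₄.1.le, f₄.2.le⟩) b₂'⟩

end Action

/-! ### Paths in the word metric -/

section Paths

open scoped Pointwise

/-- The unit ball of the word metric, as the set of the generators, their inverses and `1`. -/
def generatorSet (S : Finset G) : Set G := {x | x = 1 ∨ x ∈ S ∨ x⁻¹ ∈ S}

lemma finite_generatorSet (S : Finset G) : (generatorSet S).Finite := by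
  refine ((Set.finite_singleton 1).union
    (S.finite_toSet.union (S.finite_toSet.image fun x => x⁻¹))).subset ?_
  rintro x (h | h | h)
  · exact Or.inl h
  · exact Or.inr (Or.inl h)
  · exact Or.inr (Or.inr ⟨x⁻¹, h, inv_inv x⟩)

/-- The products of `n` elements of `generatorSet S`. -/
def wordSet (S : Finset G) (n : ℕ) : Set G := generatorSet S ^ n

lemma finite_wordSet (S : Finset G) (n : ℕ) : (wordSet S n).Finite := by
  rw [wordSet]
  induction n with
  | zero => simp
  | succ n ih => exact pow_succ (generatorSet S) n ▸ ih.mul (finite_generatorSet S)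

lemma wordSet_subset (S : Finset G) {m n : ℕ} (h : m ≤ n) : wordSet S m ⊆ wordSet S n :=
  Set.pow_subset_pow_right (Or.inl rfl : (1 : G) ∈ generatorSet S) h

lemma inv_mul_mem_of_wordDist_eq_one {S : Finset G} {g h : G} (hgh : wordDist S g h = 1) :
    g⁻¹ * h ∈ generatorSet S := by
  have hne : {n | ∃ l : List G, l.length = n ∧ (∀ x ∈ l, x ∈ S ∨ x⁻¹ ∈ S) ∧
      l.prod = g⁻¹ * h}.Nonempty := by
    apply Nat.nonempty_of_sInf_eq_succ (k := 0)
    exact hgh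
  obtain ⟨l, hl, hlS, hprod⟩ := Nat.sInf_mem hne
  obtain ⟨x, rfl⟩ := List.length_eq_one_iff.1 (hl.trans hgh)
  rw [← hprod, List.prod_singleton]
  exact Or.inr (hlS x (by simp))

lemma pathDist_le {S : Finset G} {P : List G} {p : G} (hp : p ∈ P) (g : G) :
    pathDist S P g ≤ wordDist S p g :=
  Nat.sInf_le ⟨p, hp, rfl⟩

/-- A path in the word metric, as a sequence indexed by `{0, …, n}`. -/
lemma IsPathFrom.exists_seq {S : Finset G} {P : List G} {a b : G} (h : IsPathFrom S P a b) :
    ∃ (n : ℕ) (p : ℕ → G), P.length = n + 1 ∧ p 0 = a ∧ p n = b ∧ (∀ i ≤ n, p i ∈ P) ∧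
      ∀ i d, i + d ≤ n → (p i)⁻¹ * p (i + d) ∈ wordSet S d := by
  obtain ⟨hne, hchain, ha, hb⟩ := h
  have hpos := List.length_pos_iff.2 hne
  have hget : ∀ i (hi : i < P.length), P.getD i 1 = P[i] := fun i hi => by simp [hi]
  refine ⟨P.length - 1, fun i => P.getD i 1, by omega, ?_, ?_, ?_, ?_⟩
  · simp [← List.head?_eq_getElem?, ha]
  · simp [← List.getLast?_eq_getElem?, hb]
  · intro i hi
    have hi' : i < P.length := by omega
    simpa only [hget i hi'] using List.getElem_mem hi'
  · intro i d hd
    induction d with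
    | zero => simp [wordSet]
    | succ d ih =>
      have h1 := List.isChain_iff_getElem.1 hchain (i + d) (by omega)
      rw [← hget (i + d) (by omega), ← hget (i + d + 1) (by omega)] at h1
      rw [wordSet, pow_succ]
      refine ⟨_, ih (by omega), _, inv_mul_mem_of_wordDist_eq_one h1, ?_⟩
      simp only
      group

/-- A finite sequence starting in `A` and ending in `B` has a subinterval starting in `A` and
ending in `B` whose interior avoids both. -/
lemma exists_crossing {A B : ℕ → Prop} {n : ℕ} (hA : A 0) (hB : B n) :
    ∃ s t, s ≤ t ∧ t ≤ n ∧ A s ∧ B t ∧ ∀ i, s < i → i < t → ¬ A i ∧ ¬ B i := by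
  classical
  have hex : ∃ t, B t := ⟨n, hB⟩
  have hsp := Nat.findGreatest_spec (P := A) (Nat.zero_le (Nat.find hex)) hA
  exact ⟨Nat.findGreatest A (Nat.find hex), Nat.find hex, Nat.findGreatest_le _,
    Nat.find_min' hex hB, hsp, Nat.find_spec hex, fun i h1 h2 =>
      ⟨Nat.findGreatest_is_greatest h1 h2.le, Nat.find_min hex h2⟩⟩

/-- Propagation of positions along a chain: `A i` (resp. `B i`) means being near the start
(resp. the end) of the `i`-th piece. -/
lemma chain_propagation {A B : ℕ → Prop} {m : ℕ} (hAB : ∀ i, ¬ (A i ∧ B i))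
    (hstep : ∀ i, 1 ≤ i → i < m → B i ∨ A (i + 1)) {i j : ℕ} (hi : 1 ≤ i) (hij : i < j)
    (hj : j ≤ m) : B i ∨ A j := by
  induction j, hij using Nat.le_induction with
  | base => exact hstep i hi hj
  | succ j hij ih =>
    rcases ih (by omega) with h | h
    · exact Or.inl h
    · rcases hstep j (by omega) hj with h' | h'
      · exact absurd ⟨h, h'⟩ (hAB j)
      · exact Or.inr h'

/-- A sequence crossing `m` pieces in order, with the crossings of the pieces in `I` all taking
at least `M` steps, has length at least `M * #I`. -/
lemma mul_card_le_of_crossings {A B : ℕ → ℕ → Prop} {m n : ℕ}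
    (hAB : ∀ x i, ¬ (A x i ∧ B x i))
    (hstep : ∀ x i, 1 ≤ i → i < m → B x i ∨ A x (i + 1))
    (h0 : 1 ≤ m → A 0 1) (hn : 1 ≤ m → B n m) {I : Finset ℕ} (hI : I ⊆ Finset.Icc 1 m) {M : ℝ}
    (hlong : ∀ i ∈ I, ∀ s t, s ≤ t → t ≤ n → A s i → B t i → M ≤ ((t - s - 1 : ℕ) : ℝ)) :
    M * I.card ≤ n + 1 := by
  have hmem : ∀ i ∈ I, 1 ≤ i ∧ i ≤ m := fun i hi => Finset.mem_Icc.1 (hI hi)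
  have hstart : ∀ i ∈ I, A 0 i := by
    intro i hi
    obtain ⟨h1, h2⟩ := hmem i hi
    have hA := h0 (h1.trans h2)
    rcases h1.eq_or_lt with rfl | h
    · exact hA
    · exact (chain_propagation (hAB 0) (hstep 0) le_rfl h h2).resolve_left
        fun hB => hAB 0 1 ⟨hA, hB⟩
  have hend : ∀ i ∈ I, B n i := by
    intro i hi
    obtain ⟨h1, h2⟩ := hmem i hi
    have hB := hn (h1.trans h2)
    rcases h2.eq_or_lt with rfl | h
    · exact hB
    · exact (chain_propagation (hAB n) (hstep n) h1 h le_rfl).resolve_right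
        fun hA => hAB n m ⟨hA, hB⟩
  classical
  set mid : ℕ → Finset ℕ := fun i =>
    (Finset.range (n + 1)).filter fun x => ¬ A x i ∧ ¬ B x i
  have hmid : ∀ i ∈ I, M ≤ ((mid i).card : ℝ) := by
    intro i hi
    obtain ⟨s, t, hst, htn, hs, ht, hint⟩ :=
      exists_crossing (A := fun x => A x i) (B := fun x => B x i) (hstart i hi) (hend i hi)
    refine (hlong i hi s t hst htn hs ht).trans ?_
    rw [← Nat.card_Ioo]
    refine Nat.cast_le.2 (Finset.card_le_card fun x hx => ?_)
    obtain ⟨hx1, hx2⟩ := Finset.mem_Ioo.1 hx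
    exact Finset.mem_filter.2 ⟨Finset.mem_range.2 (by omega), hint x hx1 hx2⟩
  have hlt : ∀ i ∈ I, ∀ j ∈ I, i < j → Disjoint (mid i) (mid j) := by
    intro i hi j hj hij
    refine Finset.disjoint_left.2 fun x hx hx' => ?_
    rcases chain_propagation (hAB x) (hstep x) (hmem i hi).1 hij (hmem j hj).2 with h | h
    · exact (Finset.mem_filter.1 hx).2.2 h
    · exact (Finset.mem_filter.1 hx').2.1 h
  have hdisj : (I : Set ℕ).PairwiseDisjoint mid := by
    intro i hi j hj hij
    rcases hij.lt_or_gt with h | h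
    · exact hlt i hi j hj h
    · exact (hlt j hj i hi h).symm
  have hcard : (I.biUnion mid).card ≤ n + 1 := by
    simpa using Finset.card_le_card
      (Finset.biUnion_subset.2 fun i _ => Finset.filter_subset _ (Finset.range (n + 1)) :
        I.biUnion mid ⊆ Finset.range (n + 1))
  rw [Finset.card_biUnion hdisj] at hcard
  calc M * I.card = ∑ _i ∈ I, M := by rw [Finset.sum_const, nsmul_eq_mul, mul_comm]
    _ ≤ ∑ i ∈ I, ((mid i).card : ℝ) := Finset.sum_le_sum hmid
    _ ≤ n + 1 := by exact_mod_cast hcard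

end Paths

section Alignment

variable {ρ : G → X → X} {κ : ℝ}

/-- The aligned pairs in a sequence consisting of a point, translates of a segment, and a
point. -/
lemma AlignedSeq.alignedPairs {ι : Type*} {σ : ι → X → X} {K : ℝ}
    {hisom : ∀ g, Isometry (σ g)} {Υ : GeodesicSegment X} {x y : X} {gs : ℕ → ι} {m : ℕ}
    (h : AlignedSeq K ([GeodesicSegment.point x] ++ transList σ hisom Υ gs m ++
      [GeodesicSegment.point y])) (hm : 1 ≤ m) :
    AlignedPair K (GeodesicSegment.point x) (Υ.translate (σ (gs 1)) (hisom _)) ∧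
      (∀ i, 1 ≤ i → i < m → AlignedPair K (Υ.translate (σ (gs i)) (hisom _))
        (Υ.translate (σ (gs (i + 1))) (hisom _))) ∧
      AlignedPair K (Υ.translate (σ (gs m)) (hisom _)) (GeodesicSegment.point y) := by
  have h' := List.isChain_iff_getElem.1 h
  simp only [transList, List.length_append, List.length_map, List.length_range,
    List.length_singleton] at h'
  refine ⟨?_, fun i h1 h2 => ?_, ?_⟩
  · have := h' 0 (by omega)
    simpa [List.getElem_append, List.getElem_cons, show 0 < m from hm] using this
  · have := h' i (by omega)
    obtain ⟨i, rfl⟩ := Nat.exists_eq_add_of_le' h1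
    simpa [List.getElem_append, List.getElem_cons, h2, show i < m by omega] using this
  · have := h' m (by omega)
    obtain ⟨m, rfl⟩ := Nat.exists_eq_add_of_le' hm
    simpa [List.getElem_append, List.getElem_cons] using this

lemma gromovProd_map {f : X → X} (hf : Isometry f) (x y z : X) :
    gromovProd (f x) (f y) (f z) = gromovProd x y z := by
  simp only [gromovProd, hf.dist_eq]

/-- The contraction estimate for a single path: a path that crosses `m` aligned translates of a
segment either comes close to a base point of one of them in any prescribed subfamily, or is
long. -/
lemma FourPoint.mul_card_le_length (hX : FourPoint X κ) (hκ : 0 < κ)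
    (hisom : ∀ g : G, Isometry (ρ g))
    (hmul : ∀ g h : G, ∀ x : X, ρ (g * h) x = ρ g (ρ h x))
    (S : Finset G) {K : ℝ} (hK : 0 < K) (Υ : GeodesicSegment X) {C : ℝ}
    (hC : 3 * (K + κ) + 3 * κ = C) (hlen : 2 * C < Υ.len) {M R : ℝ}
    (hclose : ∀ p : G, ∀ w ∈ wordSet S (⌈M⌉₊ + 1),
      gromovProd Υ.initial (ρ p Υ.initial) Υ.terminal ≤ C →
      gromovProd Υ.terminal (ρ (p * w) Υ.initial) Υ.initial ≤ C → (wordLength S p⁻¹ : ℝ) < R)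
    {P : List G} {a b : G} (hP : IsPathFrom S P a b) {m : ℕ} {gs : ℕ → G}
    (hal : AlignedSeq K ([GeodesicSegment.point (ρ a Υ.initial)] ++
      transList ρ hisom Υ gs m ++ [GeodesicSegment.point (ρ b Υ.initial)]))
    {I : Finset ℕ} (hI : I ⊆ Finset.Icc 1 m) (hfar : ∀ i ∈ I, R ≤ pathDist S P (gs i)) :
    M * I.card ≤ P.length := by
  obtain ⟨n, p, hn, rfl, rfl, hmem, hword⟩ := hP.exists_seq
  set γ : ℕ → GeodesicSegment X := fun i => Υ.translate (ρ (gs i)) (hisom _)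
  have hloc : ∀ (i : ℕ) (q : G), ρ q Υ.initial = ρ (gs i) (ρ ((gs i)⁻¹ * q) Υ.initial) := by
    intro i q
    rw [← hmul, mul_inv_cancel_left]
  have hlen' : ∀ i, dist (γ i).initial (γ i).terminal = Υ.len := fun i =>
    (γ i).dist_initial_terminal
  rw [hn]
  push_cast
  refine mul_card_le_of_crossings
    (A := fun x i => gromovProd (γ i).initial (ρ (p x) Υ.initial) (γ i).terminal ≤ C)
    (B := fun x i => gromovProd (γ i).terminal (ρ (p x) Υ.initial) (γ i).initial ≤ C)
    (m := m) (n := n) ?_ ?_ ?_ ?_ hI ?_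
  · rintro x i ⟨hA, hB⟩
    linarith [gromovProd_add (ρ (p x) Υ.initial) (γ i).initial (γ i).terminal, hlen' i]
  · intro x i h1 h2
    obtain ⟨e₁, e₂⟩ := (hal.alignedPairs (h1.trans h2.le)).2.1 i h1 h2
    rw [← hC]
    exact hX.gromovProd_le_or hκ (by linarith)
      ((hX.gromovProd_le_of_diam_lt (γ i) (γ (i + 1)).initial_mem).2 e₁)
      ((hX.gromovProd_le_of_diam_lt (γ i) (γ (i + 1)).terminal_mem).2 e₁)
      ((hX.gromovProd_le_of_diam_lt (γ (i + 1)) (γ i).terminal_mem).1 e₂) _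
  · intro hm
    have h := (hX.gromovProd_le_of_diam_lt (γ 1)
      (GeodesicSegment.point (ρ (p 0) Υ.initial)).initial_mem).1 (hal.alignedPairs hm).1.2
    exact h.trans (by linarith)
  · intro hm
    have h := (hX.gromovProd_le_of_diam_lt (γ m)
      (GeodesicSegment.point (ρ (p n) Υ.initial)).initial_mem).2 (hal.alignedPairs hm).2.2.1
    exact h.trans (by linarith)
  · intro i hi s t hst htn hA hB
    by_contra! hlt
    obtain ⟨d, rfl⟩ := Nat.exists_eq_add_of_le hst
    have hd : d ≤ ⌈M⌉₊ + 1 := by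
      have := Nat.cast_lt.1 (hlt.trans_le (Nat.le_ceil M))
      omega
    have hw := wordSet_subset S hd (hword s d htn)
    have hR := hclose ((gs i)⁻¹ * p s) _ hw
      (by
        rw [← gromovProd_map (hisom (gs i)), ← hloc]
        exact hA)
      (by
        rw [← gromovProd_map (hisom (gs i)), mul_assoc, mul_inv_cancel_left, ← hloc]
        exact hB)
    rw [mul_inv_rev, inv_inv] at hR
    have hle : (pathDist S P (gs i) : ℝ) ≤ wordDist S (p s) (gs i) :=
      Nat.cast_le.2 (pathDist_le (hmem s (by omega)) _)
    exact absurd (hfar i hi) (not_le.2 (hle.trans_lt hR))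

end Alignment

/-- Proposition 3.3: paths shadowing many aligned translates of `Υ_L` either come close
to one of the `g_i` (twice) or are long. -/
theorem sub_contraction {G : Type*} [Group G] {X : Type*} [MetricSpace X]
    (S : Finset G) (hSgen : Subgroup.closure (S : Set G) = ⊤)
    (hNVC : NonVirtuallyCyclic G)
    (δ : ℝ) (hδ : 0 < δ) (hgeo : IsGeodesicSpace X) (hhyp : IsDeltaHyperbolic X δ)
    (ρ : G → X → X) (hisom : ∀ g : G, Isometry (ρ g))
    (hmul : ∀ g h : G, ∀ x : X, ρ (g * h) x = ρ g (ρ h x)) (hone : ∀ x : X, ρ 1 x = x)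
    (x0 : X) (φ : G)
    (hlox : IsLoxodromic ρ x0 φ) (hwpd : HasWPD ρ x0 φ) :
    ∀ K : ℝ, 0 < K → ∃ L0 : ℝ, ∀ L : ℕ, L0 ≤ (L : ℝ) →
      ∀ Υ : GeodesicSegment X, Υ.initial = x0 → Υ.terminal = ρ (φ ^ L) x0 →
      ∀ M : ℝ, 0 < M → ∃ R0 : ℝ, 0 < R0 ∧
        ∀ (P₁ P₂ : List G) (a₁ b₁ a₂ b₂ : G),
          IsPathFrom S P₁ a₁ b₁ → IsPathFrom S P₂ a₂ b₂ →
          ∀ (m : ℕ) (gs : ℕ → G),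
            AlignedSeq K ([GeodesicSegment.point (ρ a₁ x0)] ++ transList ρ hisom Υ gs m ++
              [GeodesicSegment.point (ρ b₁ x0)]) →
            AlignedSeq K ([GeodesicSegment.point (ρ a₂ x0)] ++ transList ρ hisom Υ gs m ++
              [GeodesicSegment.point (ρ b₂ x0)]) →
            ∀ k : ℕ, k ≤ m →
              (∀ I : Finset ℕ, I ⊆ Finset.Icc 1 m → I.card = k →
                ∃ i ∈ I, (pathDist S P₁ (gs i) : ℝ) < R0 ∧ (pathDist S P₂ (gs i) : ℝ) < R0) ∨
              M * (k : ℝ) ≤ ((P₁.length : ℝ) + (P₂.length : ℝ)) := by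
  intro K hK
  have hX := hhyp.fourPoint hδ hgeo
  have hκ : 0 < 12 * δ := by linarith
  obtain ⟨C, hC⟩ : ∃ C, 3 * (K + 12 * δ) + 3 * (12 * δ) = C := ⟨_, rfl⟩
  obtain ⟨N, hN⟩ := hX.finite_setOf_dist_lt hκ.le hisom hmul hlox hwpd
    (show 0 < 2 * C + 2 * (12 * δ) + 1 by linarith)
  obtain ⟨τ, hτ, -, -, hgrowth, -⟩ := hX.orbit_growth hκ.le hisom hmul hlox
  refine ⟨max N ((2 * C + 12 * δ + 1) / τ), fun L hL Υ hΥ₀ hΥ₁ M _ => ?_⟩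
  obtain ⟨hNL, hτL⟩ := max_le_iff.1 hL
  rw [div_le_iff₀ hτ] at hτL
  have hfar : 2 * C + 12 * δ < dist x0 (ρ (φ ^ L) x0) := by linarith [hgrowth L]
  have hlen : 2 * C < Υ.len := by
    rw [← Υ.dist_initial_terminal, hΥ₀, hΥ₁]
    linarith
  have hfin := (finite_wordSet S (⌈M⌉₊ + 1)).biUnion fun w _ =>
    hX.finite_crossings hκ hisom hmul hfar (hN L (Nat.cast_le.1 hNL)) x0 w
  obtain ⟨R, hR⟩ := (hfin.image fun p => wordLength S p⁻¹).bddAbove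
  refine ⟨R + 1, by positivity, fun P₁ P₂ a₁ b₁ a₂ b₂ hP₁ hP₂ m gs h₁ h₂ k _ => ?_⟩
  have hclose : ∀ p : G, ∀ w ∈ wordSet S (⌈M⌉₊ + 1),
      gromovProd Υ.initial (ρ p Υ.initial) Υ.terminal ≤ C →
      gromovProd Υ.terminal (ρ (p * w) Υ.initial) Υ.initial ≤ C →
      (wordLength S p⁻¹ : ℝ) < R + 1 := by
    intro p w hw e₁ e₂
    rw [hΥ₀, hΥ₁] at e₁ e₂
    have : wordLength S p⁻¹ ≤ R :=
      hR (Set.mem_image_of_mem _ (Set.mem_biUnion hw ⟨e₁, e₂⟩))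
    exact_mod_cast Nat.lt_succ_of_le this
  rw [← hΥ₀] at h₁ h₂
  by_contra! hcon
  obtain ⟨⟨I, hI, rfl, hbad⟩, hshort⟩ := hcon
  classical
  have l₁ := hX.mul_card_le_length hκ hisom hmul S hK Υ hC hlen hclose hP₁ h₁
    ((I.filter_subset fun i => (R + 1 : ℝ) ≤ pathDist S P₁ (gs i)).trans hI)
    fun i hi => (Finset.mem_filter.1 hi).2
  have l₂ := hX.mul_card_le_length hκ hisom hmul S hK Υ hC hlen hclose hP₂ h₂
    ((I.filter_subset fun i => ¬ (R + 1 : ℝ) ≤ pathDist S P₁ (gs i)).trans hI)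
    fun i hi => hbad i (Finset.mem_filter.1 hi).1 (not_le.1 (Finset.mem_filter.1 hi).2)
  have hsum := I.card_filter_add_card_filter_not fun i => (R + 1 : ℝ) ≤ pathDist S P₁ (gs i)
  rw [← hsum] at hshort
  push_cast at hshort
  linarith

end AcylCount
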